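/- Let n ≥ 2 and let K₁ ⊆ K₂ be compact convex subsets of ℝⁿ with nonempty interior, such that K₂ \ K₁ has nonempty interior. Then μH^{n−1}(∂K₁) < μH^{n−1}(∂K₂), i.e. the surface area of K₁ is strictly smaller than that of K₂. -/

import Mathlib

open MeasureTheory

section Helpers

variable {E : Type*} [NormedAddCommGroup E] [InnerProductSpace ℝ E]

/-- `x` is the nearest point projection of `y` on the convex set `K`. -/
def IsProjPt (K : Set E) (y x : E) : Prop :=
  x ∈ K ∧ ∀ w ∈ K, inner ℝ (y - x) (w - x) ≤ 0

lemma IsProjPt.dist_le {K : Set E} {y x y' x' : E} (h : IsProjPt K y x)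
    (h' : IsProjPt K y' x') : dist x x' ≤ dist y y' := by
  have h1 := h.2 x' h'.1
  have h2 := h'.2 x h.1
  rw [dist_eq_norm, dist_eq_norm]
  have h3 : inner ℝ (x - x') (x - x') ≤ inner ℝ (y - y') (x - x') := by
    have e : inner ℝ (y - y') (x - x') - inner ℝ (x - x') (x - x')
        = - inner ℝ (y - x) (x' - x) - inner ℝ (y' - x') (x - x') := by
      simp only [inner_sub_left, inner_sub_right]
      ring
    linarith
  rw [real_inner_self_eq_norm_sq] at h3
  have h4 := real_inner_le_norm (y - y') (x - x')
  by_contra! h5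
  nlinarith [norm_nonneg (x - x'), norm_nonneg (y - y')]

lemma exists_isProjPt [CompleteSpace E] {K : Set E} (hK : IsClosed K) (hc : Convex ℝ K)
    (hne : K.Nonempty) (y : E) : ∃ x, IsProjPt K y x := by
  obtain ⟨x, hx, h⟩ := exists_norm_eq_iInf_of_complete_convex hne hK.isComplete hc y
  exact ⟨x, hx, (norm_eq_iInf_iff_real_inner_le_zero hc hx).1 h⟩

lemma isProjPt_self {K : Set E} {x : E} (hx : x ∈ K) : IsProjPt K x x :=
  ⟨hx, fun w _ => by simp⟩

lemma isProjPt_closedBall {c z : E} {r s : ℝ} (hz : dist z c = r) (hs : 0 ≤ s) :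
    IsProjPt (Metric.closedBall c r) (z + s • (z - c)) z := by
  refine ⟨by simp [hz], fun w hw => ?_⟩
  rw [Metric.mem_closedBall, dist_eq_norm] at hw
  rw [dist_eq_norm] at hz
  rw [add_sub_cancel_left, inner_smul_left]
  have e : inner ℝ (z - c) (w - z) = inner ℝ (z - c) (w - c) - ‖z - c‖ ^ 2 := by
    rw [← real_inner_self_eq_norm_sq, ← inner_sub_right]
    congr 1
    abel
  have h1 := real_inner_le_norm (z - c) (w - c)
  have h2 : inner ℝ (z - c) (w - z) ≤ 0 := by
    rw [e]
    nlinarith [norm_nonneg (z - c)]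
  simpa using mul_nonpos_of_nonneg_of_nonpos hs h2

lemma isProjPt_closedBall' {c y : E} {r : ℝ} (hr : 0 < r) (hy : r ≤ dist y c) :
    IsProjPt (Metric.closedBall c r) y (c + (r / dist y c) • (y - c)) := by
  have hd : 0 < dist y c := hr.trans_le hy
  have h := isProjPt_closedBall (c := c) (z := c + (r / dist y c) • (y - c)) (r := r)
    (s := dist y c / r - 1) (by
      rw [dist_eq_norm, add_sub_cancel_left, norm_smul, ← dist_eq_norm]
      rw [Real.norm_of_nonneg (by positivity)]
      field_simp) (by
      rw [sub_nonneg, le_div_iff₀ hr]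
      linarith)
  convert h using 1
  rw [add_sub_cancel_left, smul_smul]
  have : (dist y c / r - 1) * (r / dist y c) = 1 - r / dist y c := by
    field_simp
  rw [this, sub_smul, one_smul]
  abel

lemma preconnected_inter_frontier {S C : Set E} (hS : IsPreconnected S)
    (h1 : (S ∩ C).Nonempty) (h2 : (S ∩ Cᶜ).Nonempty) : (S ∩ frontier C).Nonempty := by
  by_contra hne
  have hno : ∀ a ∈ S, a ∉ frontier C := fun a ha h => hne ⟨a, ha, h⟩
  obtain ⟨a, ha, haC⟩ := h1
  obtain ⟨b, hb, hbC⟩ := h2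
  have hcov : ∀ a ∈ S, a ∈ interior C ∨ a ∈ (closure C)ᶜ := by
    intro a ha
    by_contra! h
    exact hno a ha ⟨not_not.1 h.2, h.1⟩
  obtain ⟨z, -, hz1, hz2⟩ := hS (interior C) (closure C)ᶜ isOpen_interior
    isClosed_closure.isOpen_compl hcov
    ⟨a, ha, (hcov a ha).resolve_right fun h => h (subset_closure haC)⟩
    ⟨b, hb, (hcov b hb).resolve_left fun h => hbC (interior_subset h)⟩
  exact hz2 (subset_closure (interior_subset hz1))

lemma exists_ray_frontier {C : Set E} (hC : Bornology.IsBounded C) {x v : E} (hx : x ∈ C)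
    (hv : v ≠ 0) : ∃ t : ℝ, 0 ≤ t ∧ x + t • v ∈ frontier C := by
  have hp : IsPreconnected ((fun t : ℝ => x + t • v) '' Set.Ici 0) :=
    isPreconnected_Ici.image _ (by fun_prop)
  obtain ⟨R, hR⟩ := hC.subset_closedBall x
  have hv' : 0 < ‖v‖ := norm_pos_iff.2 hv
  have := preconnected_inter_frontier hp (C := C) ⟨x, ⟨0, by simp, by simp⟩, hx⟩
    ⟨x + ((|R| + 1) / ‖v‖) • v, ⟨_, by simp; positivity, rfl⟩, fun h => by
      have h2 := hR h
      rw [Metric.mem_closedBall, dist_eq_norm, add_sub_cancel_left, norm_smul,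
        Real.norm_of_nonneg (by positivity), div_mul_cancel₀ _ hv'.ne'] at h2
      linarith [le_abs_self R]⟩
  obtain ⟨_, ⟨t, ht, rfl⟩, h⟩ := this
  exact ⟨t, ht, h⟩

lemma exists_normal [CompleteSpace E] {K : Set E} (hK : IsClosed K) (hc : Convex ℝ K)
    (hi : (interior K).Nonempty) {x : E} (hx : x ∈ frontier K) :
    ∃ v : E, v ≠ 0 ∧ ∀ t : ℝ, 0 ≤ t → IsProjPt K (x + t • v) x := by
  obtain ⟨f, hf⟩ := geometric_hahn_banach_open_point hc.interior isOpen_interior hx.2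
  have hxK : x ∈ K := hK.frontier_subset hx
  have hle : ∀ a ∈ K, f a ≤ f x := by
    intro a ha
    have h1 : a ∈ closure (interior K) := by
      rw [hc.closure_interior_eq_closure_of_nonempty_interior hi]
      exact subset_closure ha
    exact closure_minimal (fun b hb => (hf b hb).le)
      (isClosed_le f.continuous continuous_const) h1
  have hin : ∀ w, inner ℝ ((InnerProductSpace.toDual ℝ E).symm f) w = f w := fun w => by
    simp
  refine ⟨(InnerProductSpace.toDual ℝ E).symm f, ?_, fun t ht => ⟨hxK, fun w hw => ?_⟩⟩
  · intro h0
    obtain ⟨a, ha⟩ := hi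
    have := hf a ha
    rw [← hin, ← hin, h0] at this
    simp at this
  · rw [add_sub_cancel_left, inner_smul_left, hin, map_sub]
    exact mul_nonpos_of_nonneg_of_nonpos (by simpa using ht) (by linarith [hle w hw])

lemma frontier_subset_proj [CompleteSpace E] {K C : Set E} (hK : IsClosed K) (hc : Convex ℝ K)
    (hi : (interior K).Nonempty) (hC : Bornology.IsBounded C) (hKC : K ⊆ C) {x : E}
    (hx : x ∈ frontier K) : ∃ y ∈ frontier C, IsProjPt K y x := by
  obtain ⟨v, hv, h⟩ := exists_normal hK hc hi hx
  obtain ⟨t, ht, h'⟩ := exists_ray_frontier hC (hKC (hK.frontier_subset hx)) hv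
  exact ⟨_, h', h t ht⟩

lemma frontier_inter_ball_proj {K : Set E} (hK : IsCompact K) {c : E} {r : ℝ} (hr : 0 < r)
    {z : E} (hz : z ∈ frontier (K ∩ Metric.closedBall c r)) :
    ∃ y ∈ frontier K, IsProjPt (Metric.closedBall c r) y z := by
  rcases frontier_inter_subset _ _ hz with h | h
  · rw [Metric.isClosed_closedBall.closure_eq] at h
    exact ⟨z, h.1, isProjPt_self h.2⟩
  · rw [hK.isClosed.closure_eq] at h
    have hzc : dist z c = r := Metric.frontier_closedBall_subset_sphere h.2
    obtain ⟨t, ht, h'⟩ := exists_ray_frontier hK.isBounded h.1 (v := z - c)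
      (by
        intro h0
        rw [sub_eq_zero] at h0
        rw [h0, dist_self] at hzc
        exact hr.ne hzc)
    exact ⟨_, h', isProjPt_closedBall hzc ht⟩

/-- A ball containing `K` but not `p`. -/
lemma exists_ball_separating [CompleteSpace E] {K : Set E} (hK : IsCompact K) (hc : Convex ℝ K)
    (hne : K.Nonempty) {p : E} (hp : p ∉ K) :
    ∃ (c : E) (r : ℝ), 0 < r ∧ K ⊆ Metric.closedBall c r ∧ r < dist p c := by
  obtain ⟨q, hq, hq'⟩ := exists_isProjPt hK.isClosed hc hne p
  obtain ⟨D, hD⟩ := hK.isBounded.subset_closedBall p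
  have hw : 0 < ‖p - q‖ := norm_pos_iff.2 (sub_ne_zero.2 (fun h => hp (h ▸ hq)))
  set w := p - q with hwdef
  set R : ℝ := D ^ 2 / ‖w‖ ^ 2 + 1 with hR
  have hRw : R * ‖w‖ ^ 2 = D ^ 2 + ‖w‖ ^ 2 := by
    rw [hR]; field_simp
  have hlt : ∀ a ∈ K, dist a (p - R • w) < dist p (p - R • w) := by
    intro a ha
    have h1 := hq' a ha
    have h2 : ‖a - p‖ ≤ D := by
      have := hD ha
      rwa [Metric.mem_closedBall, dist_eq_norm] at this
    have h3 : inner ℝ w (a - p) = inner ℝ w (a - q) - ‖w‖ ^ 2 := by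
      rw [← real_inner_self_eq_norm_sq, ← inner_sub_right, hwdef]
      congr 1
      abel
    rw [dist_eq_norm, dist_eq_norm]
    have e1 : a - (p - R • w) = (a - p) + R • w := by abel
    have e2 : p - (p - R • w) = R • w := by abel
    rw [e1, e2]
    refine lt_of_pow_lt_pow_left₀ 2 (norm_nonneg _) ?_
    rw [norm_add_sq_real, inner_smul_right, real_inner_comm, h3]
    have hRp : 0 < R := by positivity
    have h5 : ‖a - p‖ ^ 2 ≤ D ^ 2 := pow_le_pow_left₀ (norm_nonneg _) h2 2
    have h6 : R * inner ℝ w (a - q) ≤ 0 := mul_nonpos_of_nonneg_of_nonpos hRp.le h1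
    nlinarith [sq_nonneg D, pow_pos hw 2]
  obtain ⟨a, ha, hmax⟩ := hK.exists_isMaxOn hne
    (f := fun a => dist a (p - R • w)) (by fun_prop)
  have h0 := hlt a ha
  have h1 : 0 ≤ dist a (p - R • w) := dist_nonneg
  refine ⟨p - R • w, (dist a (p - R • w) + dist p (p - R • w)) / 2, by linarith, ?_, by linarith⟩
  intro b hb
  have : dist b (p - R • w) ≤ dist a (p - R • w) := hmax hb
  rw [Metric.mem_closedBall]
  linarith

end Helpers

lemma frontier_cube_finite (m : ℕ) (R : ℝ) :
    μH[(m : ℝ)] {x : EuclideanSpace ℝ (Fin (m + 1)) | (∀ j, |x j| ≤ R) ∧ ∃ i, |x i| = R} < ⊤ := by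
  let g : Fin (m + 1) → ℝ → (Fin m → ℝ) → EuclideanSpace ℝ (Fin (m + 1)) :=
    fun i s y => WithLp.toLp 2 (i.insertNth s y)
  have hg : ∀ i s, μH[(m : ℝ)] (g i s '' (Set.Icc (fun _ => -R) (fun _ => R))) < ⊤ := by
    intro i s
    have hl : LipschitzWith 1 (fun y : Fin m → ℝ => (i.insertNth s y : Fin (m + 1) → ℝ)) := by
      refine LipschitzWith.of_dist_le_mul fun y z => ?_
      rw [NNReal.coe_one, one_mul, dist_pi_le_iff dist_nonneg]
      intro j
      refine Fin.succAboveCases i ?_ (fun k => ?_) j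
      · simp
      · simpa using dist_le_pi_dist y z k
    have hl2 := (PiLp.lipschitzWith_toLp 2 (fun _ : Fin (m + 1) => ℝ)).comp hl
    have h3 := (hl2.lipschitzOnWith (s := Set.Icc (fun _ => -R) (fun _ => R))).hausdorffMeasure_image_le
      (d := (m : ℝ)) (by positivity)
    refine lt_of_le_of_lt h3 (ENNReal.mul_lt_top (ENNReal.rpow_lt_top_of_nonneg (by positivity) (by simp)) ?_)
    have hv := hausdorffMeasure_pi_real (ι := Fin m)
    rw [Fintype.card_fin] at hv
    rw [hv]
    exact isCompact_Icc.measure_lt_top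
  refine lt_of_le_of_lt (measure_mono (t := ⋃ i, (g i R '' (Set.Icc (fun _ => -R) (fun _ => R)) ∪
    g i (-R) '' (Set.Icc (fun _ => -R) (fun _ => R)))) ?_) ?_
  · rintro x ⟨hx, i, hi⟩
    rw [Set.mem_iUnion]
    refine ⟨i, ?_⟩
    have hmem : i.removeNth (fun j => x j) ∈ Set.Icc (fun _ : Fin m => -R) (fun _ => R) :=
      ⟨fun k => (abs_le.1 (hx _)).1, fun k => (abs_le.1 (hx _)).2⟩
    have hself : g i (x i) (i.removeNth (fun j => x j)) = x := by
      ext j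
      simp [g]
    rcases eq_or_eq_neg_of_abs_eq hi with h | h
    · left
      exact ⟨_, hmem, by rw [← h]; exact hself⟩
    · right
      exact ⟨_, hmem, by rw [← h]; exact hself⟩
  · refine lt_of_le_of_lt (measure_iUnion_le _) ?_
    rw [tsum_fintype]
    exact ENNReal.sum_lt_top.2 fun i _ => lt_of_le_of_lt (measure_union_le _ _)
      (ENNReal.add_lt_top.2 ⟨hg i R, hg i (-R)⟩)

lemma frontier_finite (m : ℕ) {K : Set (EuclideanSpace ℝ (Fin (m + 1)))}
    (hK : IsCompact K) (hc : Convex ℝ K) (hi : (interior K).Nonempty) :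
    μH[(m : ℝ)] (frontier K) < ⊤ := by
  obtain ⟨R, hR⟩ := hK.isBounded.subset_closedBall 0
  let C : Set (EuclideanSpace ℝ (Fin (m + 1))) := {x | ∀ j, |x j| ≤ R}
  have hKC : K ⊆ C := by
    intro x hx j
    have := hR hx
    rw [mem_closedBall_zero_iff] at this
    exact (PiLp.norm_apply_le x j).trans this
  have hCb : Bornology.IsBounded C := by
    have h1 : Bornology.IsBounded (Metric.closedBall (0 : Fin (m + 1) → ℝ) |R|) :=
      Metric.isBounded_closedBall
    have h2 := (PiLp.lipschitzWith_toLp 2 (fun _ : Fin (m + 1) => ℝ)).isBounded_image h1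
    refine h2.subset fun x hx => ⟨WithLp.ofLp x, ?_, rfl⟩
    rw [mem_closedBall_zero_iff, pi_norm_le_iff_of_nonneg (abs_nonneg R)]
    exact fun j => (hx j).trans (le_abs_self R)
  have hCc : IsClosed C := by
    have : C = ⋂ j, {x | |x j| ≤ R} := by ext; simp [C]
    rw [this]
    exact isClosed_iInter fun j => isClosed_le (by fun_prop) continuous_const
  have hCo : IsOpen {x : EuclideanSpace ℝ (Fin (m + 1)) | ∀ j, |x j| < R} := by
    have : {x : EuclideanSpace ℝ (Fin (m + 1)) | ∀ j, |x j| < R} = ⋂ j, {x | |x j| < R} := by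
      ext; simp
    rw [this]
    exact isOpen_iInter_of_finite fun j => isOpen_lt (by fun_prop) continuous_const
  have hfr : frontier C ⊆ {x | (∀ j, |x j| ≤ R) ∧ ∃ i, |x i| = R} := by
    intro x hx
    have hxC : x ∈ C := hCc.frontier_subset hx
    refine ⟨hxC, ?_⟩
    by_contra! h
    exact hx.2 (interior_maximal (fun y hy j => (hy j).le) hCo
      (fun j => lt_of_le_of_ne (hxC j) (h j)))
  have hne : K.Nonempty := hi.mono interior_subset
  choose P hP using exists_isProjPt hK.isClosed hc hne
  have hsub : frontier K ⊆ P '' frontier C := by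
    intro x hx
    obtain ⟨y, hy, h⟩ := frontier_subset_proj hK.isClosed hc hi hCb hKC hx
    refine ⟨y, hy, ?_⟩
    have := (hP y).dist_le h
    rw [dist_self] at this
    exact dist_le_zero.1 this
  have hl : LipschitzOnWith 1 P (frontier C) :=
    LipschitzOnWith.of_dist_le_mul fun y _ z _ => by simpa using (hP y).dist_le (hP z)
  have h1 := hl.hausdorffMeasure_image_le (d := (m : ℝ)) (by positivity)
  simp only [ENNReal.coe_one, ENNReal.one_rpow, one_mul] at h1
  exact (measure_mono hsub).trans_lt (h1.trans_lt ((measure_mono hfr).trans_lt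
    (frontier_cube_finite m R)))

lemma frontier_cap_pos (m : ℕ) {K : Set (EuclideanSpace ℝ (Fin (m + 1)))}
    (hK : IsCompact K) {c p : EuclideanSpace ℝ (Fin (m + 1))} {r : ℝ} (hr : 0 < r)
    (hp : p ∈ interior K) (hpr : r < dist p c) :
    0 < μH[(m : ℝ)] (frontier K \ Metric.ball c r) := by
  set u := p - c with hu
  have hu0 : u ≠ 0 := by
    intro h
    rw [hu, sub_eq_zero] at h
    rw [h, dist_self] at hpr
    linarith
  have : Fact (Module.finrank ℝ (EuclideanSpace ℝ (Fin (m + 1))) = m + 1) := ⟨by simp⟩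
  have hfin : Module.finrank ℝ (ℝ ∙ u)ᗮ = Module.finrank ℝ (Fin m → ℝ) := by
    rw [Submodule.finrank_orthogonal_span_singleton (n := m) hu0]; simp
  let e : (ℝ ∙ u)ᗮ ≃L[ℝ] (Fin m → ℝ) := ContinuousLinearEquiv.ofFinrankEq hfin
  let T : EuclideanSpace ℝ (Fin (m + 1)) →L[ℝ] (Fin m → ℝ) :=
    e.toContinuousLinearMap.comp ((ℝ ∙ u)ᗮ.orthogonalProjectionOnto)
  have hTu : T u = 0 := by
    have : (ℝ ∙ u)ᗮ.orthogonalProjectionOnto u = 0 :=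
      Submodule.orthogonalProjectionOnto_orthogonalComplement_singleton_eq_zero u
    simp [T, this]
  have hTs : Function.Surjective T := by
    intro y
    refine ⟨(e.symm y : EuclideanSpace ℝ (Fin (m + 1))), ?_⟩
    simp [T]
  have hTo : IsOpenMap T := T.isOpenMap hTs
  let U : Set (EuclideanSpace ℝ (Fin (m + 1))) :=
    interior K ∩ ({q | r < dist q c} ∩ {q | 0 < inner ℝ (q - c) u})
  have hU : IsOpen U := isOpen_interior.inter
    ((isOpen_lt continuous_const (by fun_prop)).inter (isOpen_lt continuous_const (by fun_prop)))
  have hpU : p ∈ U := ⟨hp, hpr, by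
    change 0 < inner ℝ (p - c) u
    rw [← hu, real_inner_self_eq_norm_sq]
    have := norm_pos_iff.2 hu0
    positivity⟩
  have hsub : T '' U ⊆ T '' (frontier K \ Metric.ball c r) := by
    rintro _ ⟨q, ⟨hq1, hq2, hq3⟩, rfl⟩
    obtain ⟨t, ht, h⟩ := exists_ray_frontier hK.isBounded (interior_subset hq1) hu0
    refine ⟨q + t • u, ⟨h, ?_⟩, by simp [hTu]⟩
    rw [Metric.mem_ball, not_lt]
    refine (le_of_lt hq2).trans ?_
    rw [dist_eq_norm, dist_eq_norm]
    refine le_of_sq_le_sq ?_ (norm_nonneg _)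
    rw [show q + t • u - c = (q - c) + t • u by abel, norm_add_sq_real, inner_smul_right]
    have : 0 ≤ t * inner ℝ (q - c) u := mul_nonneg ht (le_of_lt hq3)
    nlinarith [sq_nonneg ‖t • u‖]
  have hpos : 0 < μH[(m : ℝ)] (T '' U) := by
    have hv := hausdorffMeasure_pi_real (ι := Fin m)
    rw [Fintype.card_fin] at hv
    rw [hv]
    exact (hTo U hU).measure_pos _ ⟨_, p, hpU, rfl⟩
  have h1 := (T.lipschitz.lipschitzOnWith (s := frontier K \ Metric.ball c r)).hausdorffMeasure_image_le
      (d := (m : ℝ)) (by positivity)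
  have h2 := (hpos.trans_le (measure_mono hsub)).trans_le h1
  exact pos_of_mul_pos_right h2 zero_le

/-- Strict monotonicity of surface area of convex bodies under inclusion when
`K₂ \ K₁` has nonempty interior ("Archimedes' axiom", strict case `i = 0 < n - 1`). -/
theorem surface_area_strict_mono (n : ℕ) (hn : 2 ≤ n)
    (K₁ K₂ : Set (EuclideanSpace ℝ (Fin n)))
    (hK₁c : IsCompact K₁) (hK₁conv : Convex ℝ K₁) (hK₁int : (interior K₁).Nonempty)
    (hK₂c : IsCompact K₂) (hK₂conv : Convex ℝ K₂) (hK₂int : (interior K₂).Nonempty)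
    (hsub : K₁ ⊆ K₂) (hdiff : (interior (K₂ \ K₁)).Nonempty) :
    μH[(n : ℝ) - 1] (frontier K₁) < μH[(n : ℝ) - 1] (frontier K₂) := by
  obtain ⟨m, rfl⟩ : ∃ m, n = m + 1 := ⟨n - 1, by omega⟩
  have hm : 0 < (m : ℝ) := by
    have : 0 < m := by omega
    exact_mod_cast this
  rw [show ((m + 1 : ℕ) : ℝ) - 1 = (m : ℝ) by push_cast; ring]
  obtain ⟨p, hp⟩ := hdiff
  have hp2 : p ∈ interior K₂ := interior_mono Set.sdiff_subset hp
  have hne₁ : K₁.Nonempty := hK₁int.mono interior_subset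
  obtain ⟨c, r, hr, hKr, hrp⟩ := exists_ball_separating hK₁c hK₁conv hne₁ (interior_subset hp).2
  obtain ⟨s, hrs, hsp⟩ := exists_between hrp
  have hs : 0 < s := hr.trans hrs
  choose P hP using exists_isProjPt hK₁c.isClosed hK₁conv hne₁
  choose Q hQ using exists_isProjPt (E := EuclideanSpace ℝ (Fin (m + 1)))
    (Metric.isClosed_closedBall (x := c) (ε := r)) (convex_closedBall c r)
    (Metric.nonempty_closedBall.2 hr.le)
  set A := frontier K₂ \ Metric.ball c s with hA
  have hPeq : ∀ {y x}, IsProjPt K₁ y x → P y = x := fun {y x} h => by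
    have := (hP y).dist_le h
    rw [dist_self] at this
    exact dist_le_zero.1 this
  have hQeq : ∀ {y x}, IsProjPt (Metric.closedBall c r) y x → Q y = x := fun {y x} h => by
    have := (hQ y).dist_le h
    rw [dist_self] at this
    exact dist_le_zero.1 this
  have hcover : frontier K₁ ⊆ P '' (Q '' (frontier K₂)) := by
    intro x hx
    obtain ⟨z, hz, h⟩ := frontier_subset_proj hK₁c.isClosed hK₁conv hK₁int
      (hK₂c.isBounded.subset Set.inter_subset_left) (Set.subset_inter hsub hKr) hx
    obtain ⟨y, hy, h'⟩ := frontier_inter_ball_proj hK₂c hr hz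
    exact ⟨z, ⟨y, hy, hQeq h'⟩, hPeq h⟩
  have hPl : LipschitzWith 1 P :=
    LipschitzWith.of_dist_le_mul fun y z => by simpa using (hP y).dist_le (hP z)
  have hQl : LipschitzWith 1 Q :=
    LipschitzWith.of_dist_le_mul fun y z => by simpa using (hQ y).dist_le (hQ z)
  have hQA : LipschitzOnWith (r / s).toNNReal Q A := by
    refine LipschitzOnWith.of_dist_le_mul fun y hy z hz => ?_
    rw [Real.coe_toNNReal _ (by positivity)]
    have hy' : s ≤ dist y c := not_lt.1 hy.2
    have hz' : s ≤ dist z c := not_lt.1 hz.2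
    have h1 := (isProjPt_closedBall' hs hy').dist_le (isProjPt_closedBall' hs hz')
    rw [hQeq (isProjPt_closedBall' hr (hrs.le.trans hy')),
      hQeq (isProjPt_closedBall' hr (hrs.le.trans hz'))]
    have e : ∀ w, (r / dist w c) • (w - c) = (r / s) • ((s / dist w c) • (w - c)) := by
      intro w
      rw [smul_smul]
      congr 1
      field_simp
    rw [dist_add_left] at h1 ⊢
    rw [e y, e z, dist_smul₀, Real.norm_of_nonneg (by positivity)]
    gcongr
  have hApos : 0 < μH[(m : ℝ)] A := frontier_cap_pos m hK₂c hs hp2 hsp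
  have hfin : μH[(m : ℝ)] (frontier K₂) < ⊤ := frontier_finite m hK₂c hK₂conv hK₂int
  have hAfin : μH[(m : ℝ)] A < ⊤ := (measure_mono Set.sdiff_subset).trans_lt hfin
  have hsplit : μH[(m : ℝ)] (frontier K₂) =
      μH[(m : ℝ)] (frontier K₂ ∩ Metric.ball c s) + μH[(m : ℝ)] A :=
    (measure_inter_add_sdiff _ Metric.isOpen_ball.measurableSet).symm
  have hBfin : μH[(m : ℝ)] (frontier K₂ ∩ Metric.ball c s) < ⊤ :=
    (measure_mono Set.inter_subset_left).trans_lt hfin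
  have h1 : μH[(m : ℝ)] (frontier K₁) ≤ μH[(m : ℝ)] (Q '' (frontier K₂)) := by
    refine (measure_mono hcover).trans ?_
    simpa using (hPl.lipschitzOnWith (s := Q '' (frontier K₂))).hausdorffMeasure_image_le hm.le
  have h2 : μH[(m : ℝ)] (Q '' (frontier K₂ ∩ Metric.ball c s)) ≤
      μH[(m : ℝ)] (frontier K₂ ∩ Metric.ball c s) := by
    simpa using (hQl.lipschitzOnWith
      (s := frontier K₂ ∩ Metric.ball c s)).hausdorffMeasure_image_le hm.le
  have h3 : μH[(m : ℝ)] (Q '' A) < μH[(m : ℝ)] A := by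
    refine (hQA.hausdorffMeasure_image_le hm.le).trans_lt ?_
    have hk : (((r / s).toNNReal : NNReal) : ENNReal) ^ (m : ℝ) < 1 := by
      refine ENNReal.rpow_lt_one ?_ hm
      have : (r / s).toNNReal < 1 := by
        rw [Real.toNNReal_lt_one]
        exact (div_lt_one hs).2 hrs
      exact_mod_cast this
    calc _ < 1 * μH[(m : ℝ)] A := ENNReal.mul_lt_mul_left hApos.ne' hAfin.ne hk
      _ = _ := one_mul _
  calc μH[(m : ℝ)] (frontier K₁) ≤ μH[(m : ℝ)] (Q '' (frontier K₂)) := h1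
    _ ≤ μH[(m : ℝ)] (Q '' (frontier K₂ ∩ Metric.ball c s)) + μH[(m : ℝ)] (Q '' A) := by
        rw [← Set.inter_union_sdiff (frontier K₂) (Metric.ball c s), Set.image_union,
          Set.inter_union_sdiff]
        exact measure_union_le _ _
    _ < μH[(m : ℝ)] (frontier K₂ ∩ Metric.ball c s) + μH[(m : ℝ)] A :=
        ENNReal.add_lt_add_of_le_of_lt (h2.trans_lt hBfin).ne h2 h3
    _ = _ := hsplit.symm
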